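/- arXiv:2001.06022 — 4 statements merged into one kernel-verified Lean document; each statement's English description precedes it below -/
import Mathlib

section
/- Let f, h ∈ W be real vectors (σ f = f and σ h = h), let τ ∈ ℂ with Im τ ≠ 0, and let B ≤ W be a complex subspace such that f − τ • h ∈ B. Let A ≤ W be a further complex subspace with (A ⊔ σ(A)) ⊓ (B ⊔ σ(B)) = ⊥. Then (span_ℂ {f, h}) ⊓ (A ⊔ σ(A)) = ⊥. (In the geometric setting, with A modeling H^{3,0}(X), this says the flux subspace H_flux spanned by f and h is purely of Hodge type (2,1) + (1,2), having no (3,0) or (0,3) component.) -/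
theorem susy_flux_span_pure_hodge_type
    {W : Type*} [AddCommGroup W] [Module ℂ W]
    (σ : W →ₛₗ[starRingEnd ℂ] W) (hσ : ∀ v, σ (σ v) = v)
    (f h : W) (hf : σ f = f) (hh : σ h = h)
    (τ : ℂ) (hτ : τ.im ≠ 0)
    (B : Submodule ℂ W) (hG : f - τ • h ∈ B)
    (A : Submodule ℂ W) (hAB : (A ⊔ A.map σ) ⊓ (B ⊔ B.map σ) = ⊥) :
    Submodule.span ℂ {f, h} ⊓ (A ⊔ A.map σ) = ⊥ := by
  have h1 : f - τ • h ∈ B ⊔ B.map σ := Submodule.mem_sup_left hG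
  have h2 : f - (starRingEnd ℂ τ) • h ∈ B ⊔ B.map σ := by
    apply Submodule.mem_sup_right
    refine ⟨f - τ • h, hG, ?_⟩
    rw [map_sub, LinearMap.map_smulₛₗ, hf, hh]
  have hne : starRingEnd ℂ τ - τ ≠ 0 := by
    intro h0
    exact hτ (Complex.conj_eq_iff_im.mp (sub_eq_zero.mp h0))
  have h3 : (starRingEnd ℂ τ - τ) • h ∈ B ⊔ B.map σ := by
    have h4 := Submodule.sub_mem _ h1 h2
    have e : f - τ • h - (f - (starRingEnd ℂ τ) • h) = (starRingEnd ℂ τ - τ) • h := by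
      rw [sub_smul]; abel
    rwa [e] at h4
  have hhm : h ∈ B ⊔ B.map σ := (Submodule.smul_mem_iff _ hne).mp h3
  have hfm : f ∈ B ⊔ B.map σ := by
    have h5 := Submodule.add_mem _ h1 (Submodule.smul_mem _ τ hhm)
    rwa [sub_add_cancel] at h5
  have hle : Submodule.span ℂ {f, h} ≤ B ⊔ B.map σ := by
    rw [Submodule.span_le]
    rintro x (rfl | rfl)
    · exact hfm
    · exact hhm
  rw [eq_bot_iff, ← hAB, inf_comm]
  exact inf_le_inf_left _ hle
end

section
/- Let B ≤ W be a complex subspace with dim_ℂ B = 1 and B ⊓ σ(B) = ⊥, and let f, h ∈ W be real vectors (σ f = f and σ h = h) that lie in B ⊔ σ(B) and are linearly independent over ℝ. Then there exists τ ∈ ℂ with Im τ ≠ 0 such that f − τ • h ∈ B. (This is the linear-algebra content of the claim that any rank-two attractor on a Calabi–Yau threefold with h^{2,1} = 1 defines a supersymmetric flux vacuum: given two independent real flux vectors of Hodge type (2,1) + (1,2), the axiodilaton can be tuned so that G₃ = f − τh ∈ H^{2,1}.) -/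
theorem rank_two_attractor_gives_susy_flux_vacuum
    {W : Type*} [AddCommGroup W] [Module ℂ W] [Module ℝ W] [IsScalarTower ℝ ℂ W]
    (σ : W →ₛₗ[starRingEnd ℂ] W) (hσ : ∀ v, σ (σ v) = v)
    (B : Submodule ℂ W) (hdim : Module.finrank ℂ B = 1) (hB : B ⊓ B.map σ = ⊥)
    (f h : W) (hf : σ f = f) (hh : σ h = h)
    (hfB : f ∈ B ⊔ B.map σ) (hhB : h ∈ B ⊔ B.map σ)
    (hind : LinearIndependent ℝ ![f, h]) :
    ∃ τ : ℂ, τ.im ≠ 0 ∧ f - τ • h ∈ B := by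
  have key0 : ∀ v ∈ B, σ v = v → v = 0 := by
    intro v hv hs
    have : v ∈ B ⊓ B.map σ := ⟨hv, Submodule.mem_map.2 ⟨v, hv, hs⟩⟩
    rw [hB] at this
    simpa using this
  have key : ∀ v ∈ B ⊔ B.map σ, σ v = v → ∃ u ∈ B, v = u + σ u := by
    intro v hv hs
    obtain ⟨u, hu, w', hw', rfl⟩ := Submodule.mem_sup.1 hv
    obtain ⟨w, hw, rfl⟩ := Submodule.mem_map.1 hw'
    rw [map_add, hσ] at hs
    have h0 := key0 (u - w) (B.sub_mem hu hw) (by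
      rw [map_sub, sub_eq_sub_iff_add_eq_add, hs])
    obtain rfl := sub_eq_zero.1 h0
    exact ⟨u, hu, rfl⟩
  obtain ⟨u, hu, hfu⟩ := key f hfB hf
  obtain ⟨w, hw, hhw⟩ := key h hhB hh
  have hh0 : h ≠ 0 := by simpa using hind.ne_zero 1
  have hw0 : w ≠ 0 := by
    rintro rfl
    exact hh0 (by simpa using hhw)
  obtain ⟨c, hc⟩ := exists_smul_eq_of_finrank_eq_one hdim
    (x := (⟨w, hw⟩ : B)) (by simpa using hw0) ⟨u, hu⟩
  have hc : c • w = u := by simpa using congrArg Subtype.val hc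
  have hmem : f - (starRingEnd ℂ c) • h ∈ B := by
    have : f - (starRingEnd ℂ c) • h = u - (starRingEnd ℂ c) • w := by
      rw [hfu, hhw, ← hc, map_smulₛₗ, smul_add]
      abel
    rw [this]
    exact B.sub_mem hu (B.smul_mem _ hw)
  refine ⟨starRingEnd ℂ c, fun him => ?_, hmem⟩
  have hcc : starRingEnd ℂ c = c := by
    rw [Complex.conj_eq_iff_im]
    simpa using him
  rw [hcc] at hmem
  have h0 := key0 _ hmem (by rw [map_sub, map_smulₛₗ, hf, hh, hcc])
  have hre : c = (c.re : ℂ) := (Complex.conj_eq_iff_re.1 hcc).symm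
  have hs : c • h = c.re • h := by
    rw [← algebraMap_smul ℂ c.re h]
    exact congrArg (· • h) hre
  rw [hs] at h0
  have := LinearIndependent.pair_iff.1 hind 1 (-c.re) (by
    rw [one_smul, neg_smul, ← sub_eq_add_neg, h0])
  exact one_ne_zero this.1
end

section
/- Let B ≤ W be a complex subspace with dim_ℂ B = 1 and B ⊓ σ(B) = ⊥, let f, h ∈ W be real vectors (σ f = f and σ h = h) with h ≠ 0, and let τ ∈ ℂ with Im τ ≠ 0 satisfy f − τ • h ∈ B. Then span_ℂ {f, h} = B ⊔ σ(B). (This is the linear-algebra content of the claim that a supersymmetric flux vacuum on a Calabi–Yau threefold with h^{2,1} = 1 defines a rank-two attractor: the fluxes span all of H^{2,1} ⊕ H^{1,2}.) -/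
theorem susy_flux_vacuum_gives_rank_two_attractor
    {W : Type*} [AddCommGroup W] [Module ℂ W]
    (σ : W →ₛₗ[starRingEnd ℂ] W) (hσ : ∀ v, σ (σ v) = v)
    (B : Submodule ℂ W) (hdim : Module.finrank ℂ B = 1) (hB : B ⊓ B.map σ = ⊥)
    (f h : W) (hf : σ f = f) (hh : σ h = h) (hh0 : h ≠ 0)
    (τ : ℂ) (hτ : τ.im ≠ 0) (hG : f - τ • h ∈ B) :
    Submodule.span ℂ {f, h} = B ⊔ B.map σ := by
  have hd : τ - starRingEnd ℂ τ ≠ 0 := by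
    intro h0
    have h1 := congrArg Complex.im h0
    simp at h1
    exact hτ h1
  have hs : σ (f - τ • h) = f - (starRingEnd ℂ τ) • h := by
    rw [map_sub, LinearMap.map_smulₛₗ, hf, hh]
  have hdiff : σ (f - τ • h) - (f - τ • h) = (τ - starRingEnd ℂ τ) • h := by
    rw [hs, sub_smul]; abel
  have hg0 : f - τ • h ≠ 0 := by
    intro h0
    rw [h0, map_zero, sub_zero] at hdiff
    exact (smul_ne_zero hd hh0) hdiff.symm
  have hfS : f ∈ Submodule.span ℂ {f, h} := Submodule.subset_span (by simp)
  have hhS : h ∈ Submodule.span ℂ {f, h} := Submodule.subset_span (by simp)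
  have hgen : ∀ w ∈ B, ∃ c : ℂ, c • (f - τ • h) = w := by
    intro w hw
    have hne : (⟨f - τ • h, hG⟩ : B) ≠ 0 := by
      intro h0
      exact hg0 (congrArg Subtype.val h0)
    obtain ⟨c, hc⟩ := (finrank_eq_one_iff_of_nonzero' _ hne).1 hdim ⟨w, hw⟩
    exact ⟨c, congrArg Subtype.val hc⟩
  apply le_antisymm
  · have hgm : f - τ • h ∈ B ⊔ B.map σ := Submodule.mem_sup_left hG
    have hsm : σ (f - τ • h) ∈ B ⊔ B.map σ :=
      Submodule.mem_sup_right (Submodule.mem_map_of_mem hG)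
    have hhm : h ∈ B ⊔ B.map σ := by
      have h1 := sub_mem hsm hgm
      rw [hdiff] at h1
      exact (Submodule.smul_mem_iff _ hd).1 h1
    have hfm : f ∈ B ⊔ B.map σ := by
      have h1 := add_mem hgm (Submodule.smul_mem _ τ hhm)
      rwa [sub_add_cancel] at h1
    rw [Submodule.span_le]
    rintro x (rfl | rfl)
    · exact hfm
    · exact hhm
  · apply sup_le
    · intro w hw
      obtain ⟨c, rfl⟩ := hgen w hw
      exact Submodule.smul_mem _ _ (sub_mem hfS (Submodule.smul_mem _ _ hhS))
    · rintro _ ⟨w, hw, rfl⟩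
      obtain ⟨c, rfl⟩ := hgen w hw
      rw [LinearMap.map_smulₛₗ, hs]
      exact Submodule.smul_mem _ _ (sub_mem hfS (Submodule.smul_mem _ _ hhS))
end

section
/- Let F be a field with char F ≠ 2, let φ ∈ F with φ² ≠ 1, and let P = X₁⁸ + X₂⁸ + X₃⁴ + X₄⁴ + X₅⁴ − 2φ·X₁⁴X₂⁴ as a polynomial in five variables over F. If a ∈ F⁵ satisfies (∂P/∂Xᵢ)(a) = 0 for every i ∈ {1, …, 5}, then a = 0. (Hence the octic hypersurface x₁⁸ + x₂⁸ + x₃⁴ + x₄⁴ + x₅⁴ − 2φx₁⁴x₂⁴ = 0 at ψ = 0 is nonsingular away from characteristic 2 and the discriminant locus φ² = 1; in particular, for φ = 0 the Gepner point has p = 2 as its only bad prime, and for rational φ = a/b the bad primes divide 2b(a² − b²), consistent with the bad-prime lists {2,3} for φ = 1/2, {2,5} for φ = 3/5, {2,3,19} for φ = 11/8, {2,3} for φ = 2, {2} for φ = 3, {2,3} for φ = 7, and {2,5} for φ = 9.) -/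
open MvPolynomial in
theorem octic_smooth_away_from_two_and_discriminant
    {F : Type*} [Field F] (hchar : ringChar F ≠ 2)
    (φ : F) (hφ : φ ^ 2 ≠ 1) (a : Fin 5 → F)
    (ha : ∀ i : Fin 5,
      eval a (pderiv i
        (X 0 ^ 8 + X 1 ^ 8 + X 2 ^ 4 + X 3 ^ 4 + X 4 ^ 4 -
          C (2 * φ) * (X 0 ^ 4 * X 1 ^ 4) : MvPolynomial (Fin 5) F)) = 0) :
    a = 0 := by
  have h2 : (2 : F) ≠ 0 := Ring.two_ne_zero hchar
  have h4 : (4 : F) ≠ 0 := by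
    have : (4 : F) = 2 * 2 := by norm_num
    rw [this]; exact mul_ne_zero h2 h2
  have h8 : (8 : F) ≠ 0 := by
    have : (8 : F) = 4 * 2 := by norm_num
    rw [this]; exact mul_ne_zero h4 h2
  have hd : ∀ i : Fin 5, pderiv i (2 : MvPolynomial (Fin 5) F) = 0 := fun i => by
    have h : (2 : MvPolynomial (Fin 5) F) = C 2 := (map_ofNat C 2).symm
    rw [h, pderiv_C]
  have e0 := ha 0
  have e1 := ha 1
  have e2 := ha 2
  have e3 := ha 3
  have e4 := ha 4
  simp only [map_add, map_sub, Derivation.leibniz, Derivation.leibniz_pow, pderiv_X, pderiv_C,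
    Pi.single_apply, smul_eq_mul, nsmul_eq_mul, map_mul, map_pow, eval_X, eval_C, map_natCast,
    Fin.reduceEq, if_true, if_false, map_one, map_zero, mul_zero, mul_one, add_zero, zero_add,
    sub_zero, Nat.reduceSub, Nat.cast_ofNat, map_ofNat, hd] at e0 e1 e2 e3 e4
  have f0 : 8 * (a 0 ^ 3 * (a 0 ^ 4 - φ * a 1 ^ 4)) = 0 := by linear_combination e0
  have f1 : 8 * (a 1 ^ 3 * (a 1 ^ 4 - φ * a 0 ^ 4)) = 0 := by linear_combination e1
  have f2 : 4 * a 2 ^ 3 = 0 := by linear_combination e2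
  have f3 : 4 * a 3 ^ 3 = 0 := by linear_combination e3
  have f4 : 4 * a 4 ^ 3 = 0 := by linear_combination e4
  have g0 := (mul_eq_zero.mp f0).resolve_left h8
  have g1 := (mul_eq_zero.mp f1).resolve_left h8
  have z2 : a 2 = 0 := by simpa [h4] using f2
  have z3 : a 3 = 0 := by simpa [h4] using f3
  have z4 : a 4 = 0 := by simpa [h4] using f4
  have z0 : a 0 = 0 := by
    by_contra h
    have k0 := (mul_eq_zero.mp g0).resolve_left (pow_ne_zero 3 h)
    by_cases h1 : a 1 = 0
    · simp [h1, h] at k0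
    · have k1 := (mul_eq_zero.mp g1).resolve_left (pow_ne_zero 3 h1)
      have : (φ ^ 2 - 1) * a 0 ^ 4 = 0 := by linear_combination -k0 - φ * k1
      rcases mul_eq_zero.mp this with h' | h'
      · exact hφ (sub_eq_zero.mp h')
      · exact pow_ne_zero 4 h h'
  have z1 : a 1 = 0 := by simpa [z0] using g1
  funext i
  fin_cases i
  · exact z0
  · exact z1
  · exact z2
  · exact z3
  · exact z4
end
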